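/- arXiv:2210.17382 — 2 statements merged into one kernel-verified Lean document; each statement's English description precedes it below -/
import Mathlib

section
/- Let A be a unique factorization domain and let a₁, a₂ ∈ A be two nonzero coprime elements (i.e., every common divisor of a₁ and a₂ is a unit). Let M and N be flat A-modules and let Φ : M → N be an A-linear map. Suppose that Φ is injective and that for each i = 1, 2 the induced map on localizations M[aᵢ⁻¹] → N[aᵢ⁻¹] is surjective. Then Φ is bijective. -/
/-- In a flat module, if `q • x = p • y` with `p` and `q` relatively prime in a
decomposition monoid (for instance a UFD), then `x` is divisible by `p`. -/
theorem Module.Flat.exists_smul_eq_of_smul_eq_smul {A M : Type*} [CommRing A]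
    [DecompositionMonoid A] [AddCommGroup M] [Module A M] [Module.Flat A M] {p q : A}
    (hpq : IsRelPrime p q) {x y : M} (h : q • x = p • y) : ∃ z : M, p • z = x := by
  obtain ⟨k, a, z, hz, ha⟩ := Module.Flat.isTrivialRelation_of_sum_smul_eq_zero
    (f := ![q, -p]) (x := ![x, y]) (by simp [h])
  have hdvd (j : Fin k) : p ∣ a 0 j := by
    refine hpq.dvd_of_dvd_mul_left ⟨a 1 j, ?_⟩
    have := ha j
    simp only [Fin.sum_univ_two, Matrix.cons_val_zero, Matrix.cons_val_one] at this
    linear_combination this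
  choose e he using hdvd
  refine ⟨∑ j, e j • z j, ?_⟩
  have hx := hz 0
  simp only [Matrix.cons_val_zero] at hx
  simp [hx, Finset.smul_sum, smul_smul, he]

/-- If a linear map becomes surjective after localizing, every element of the target has a
multiple by an element of the submonoid that lies in the range. -/
theorem IsLocalizedModule.exists_apply_eq_smul_of_map_surjective {A M N M' N' : Type*}
    [CommRing A] [AddCommGroup M] [Module A M] [AddCommGroup N] [Module A N]
    [AddCommGroup M'] [Module A M'] [AddCommGroup N'] [Module A N'] (S : Submonoid A)
    (f : M →ₗ[A] M') (g : N →ₗ[A] N') [IsLocalizedModule S f] [IsLocalizedModule S g]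
    (Φ : M →ₗ[A] N) (h : Function.Surjective (IsLocalizedModule.map S f g Φ)) (n : N) :
    ∃ s ∈ S, ∃ m, Φ m = s • n := by
  obtain ⟨x, hx⟩ := h (g n)
  obtain ⟨⟨m, s⟩, hm⟩ := IsLocalizedModule.surj S f x
  have key : g (Φ m) = g ((s : A) • n) := by
    rw [← IsLocalizedModule.map_apply S f g Φ, ← hm, Submonoid.smul_def, map_smul, hx, map_smul]
  obtain ⟨t, ht⟩ := IsLocalizedModule.exists_of_eq (S := S) key
  refine ⟨t * s, S.mul_mem t.2 s.2, (t : A) • m, ?_⟩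
  rw [map_smul, mul_smul]
  exact ht

/-- Let `A` be a UFD and `a₁, a₂ ∈ A` two nonzero coprime elements (every common divisor
is a unit).  Let `M`, `N` be flat `A`-modules and `Φ : M → N` an `A`-linear map which is
injective and such that the induced maps `M[aᵢ⁻¹] → N[aᵢ⁻¹]` are surjective for `i = 1, 2`.
Then `Φ` is bijective. -/
theorem statement2 {A : Type*} [CommRing A] [IsDomain A] [UniqueFactorizationMonoid A]
    {M N : Type*} [AddCommGroup M] [Module A M] [AddCommGroup N] [Module A N]
    [Module.Flat A M] [Module.Flat A N]
    (a₁ a₂ : A) (ha₁ : a₁ ≠ 0) (ha₂ : a₂ ≠ 0) (hcop : IsRelPrime a₁ a₂)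
    (Φ : M →ₗ[A] N) (hinj : Function.Injective Φ)
    (hsurj₁ : Function.Surjective
      (IsLocalizedModule.map (Submonoid.powers a₁)
        (LocalizedModule.mkLinearMap (Submonoid.powers a₁) M)
        (LocalizedModule.mkLinearMap (Submonoid.powers a₁) N) Φ))
    (hsurj₂ : Function.Surjective
      (IsLocalizedModule.map (Submonoid.powers a₂)
        (LocalizedModule.mkLinearMap (Submonoid.powers a₂) M)
        (LocalizedModule.mkLinearMap (Submonoid.powers a₂) N) Φ)) :
    Function.Bijective Φ := by
  refine ⟨hinj, fun n => ?_⟩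
  obtain ⟨_, ⟨k, rfl⟩, m₁, h₁⟩ :=
    IsLocalizedModule.exists_apply_eq_smul_of_map_surjective _ _ _ Φ hsurj₁ n
  obtain ⟨_, ⟨l, rfl⟩, m₂, h₂⟩ :=
    IsLocalizedModule.exists_apply_eq_smul_of_map_surjective _ _ _ Φ hsurj₂ n
  obtain ⟨z, rfl⟩ := Module.Flat.exists_smul_eq_of_smul_eq_smul
    (p := a₁ ^ k) (q := a₂ ^ l) (x := m₁) (y := m₂) hcop.pow
    (hinj (by simp only [map_smul, h₁, h₂]; exact smul_comm _ _ _))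
  refine ⟨z, Module.Flat.isSMulRegular_of_nonZeroDivisors
    (mem_nonZeroDivisors_of_ne_zero (pow_ne_zero k ha₁)) ?_⟩
  simpa only [map_smul] using h₁
end

section
/- Let 𝕜 be an integral domain in which 2 ≠ 0. Then the mixed polynomial–Laurent polynomial ring 𝕜[X][Y, Y⁻¹] and the localization of the polynomial ring 𝕜[X, Y] away from the element Y² − 2XY are not isomorphic as 𝕜-algebras. -/
open LaurentPolynomial Polynomial MvPolynomial

/-- A unit of the Laurent polynomials over a domain is a unit constant times a power of `T`. -/
theorem LaurentPolynomial.exists_eq_C_mul_T_of_isUnit {R : Type*} [CommRing R] [IsDomain R]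
    {f : R[T;T⁻¹]} (hf : IsUnit f) :
    ∃ (r : R) (n : ℤ), IsUnit r ∧ f = LaurentPolynomial.C r * LaurentPolynomial.T n := by
  obtain ⟨n, p, hp⟩ := LaurentPolynomial.exists_T_pow f
  have hpu : IsUnit (algebraMap R[X] R[T;T⁻¹] p) := by
    rw [LaurentPolynomial.algebraMap_eq_toLaurent, hp]
    exact hf.mul (LaurentPolynomial.isUnit_T n)
  obtain ⟨k, hk⟩ :=
    (IsLocalization.Away.algebraMap_isUnit_iff (Polynomial.X : R[X])).1 hpu
  obtain ⟨i, -, hi⟩ := (dvd_prime_pow Polynomial.prime_X k).1 hk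
  obtain ⟨u, hu⟩ := hi.symm
  obtain ⟨r, hr, hru⟩ := Polynomial.isUnit_iff.1 u.isUnit
  refine ⟨r, i - n, hr, ?_⟩
  have hpT : f * LaurentPolynomial.T n =
      LaurentPolynomial.C r * LaurentPolynomial.T i := by
    rw [← hp, ← hu, ← hru, mul_comm, Polynomial.toLaurent_C_mul_X_pow]
  rw [sub_eq_add_neg, ← LaurentPolynomial.mul_T_assoc, ← hpT, LaurentPolynomial.mul_T_assoc,
    add_neg_cancel, LaurentPolynomial.T_zero, mul_one]

/-- Units of `𝕜[X][T;T⁻¹]` over a domain `𝕜` have the form `c T ^ n` with `c` a unit of `𝕜`. -/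
theorem LaurentPolynomial.exists_eq_algebraMap_mul_T_of_isUnit {𝕜 : Type*} [CommRing 𝕜]
    [IsDomain 𝕜] {f : (𝕜[X])[T;T⁻¹]} (hf : IsUnit f) :
    ∃ (c : 𝕜) (n : ℤ), c ≠ 0 ∧
      f = algebraMap 𝕜 (𝕜[X])[T;T⁻¹] c * LaurentPolynomial.T n := by
  obtain ⟨r, n, hr, rfl⟩ := LaurentPolynomial.exists_eq_C_mul_T_of_isUnit hf
  obtain ⟨c, hc, rfl⟩ := Polynomial.isUnit_iff.1 hr
  exact ⟨c, n, hc.ne_zero, rfl⟩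

/-- Any two units of `𝕜[X][T;T⁻¹]` are multiplicatively dependent modulo constants. -/
theorem LaurentPolynomial.exists_mul_pow_eq_of_isUnit {𝕜 : Type*} [CommRing 𝕜] [IsDomain 𝕜]
    {u v : (𝕜[X])[T;T⁻¹]} (hu : IsUnit u) (hv : IsUnit v) :
    ∃ (a b : ℕ) (c d : 𝕜), ¬(a = 0 ∧ b = 0) ∧ c ≠ 0 ∧ d ≠ 0 ∧
      (algebraMap 𝕜 _ d * u ^ a = algebraMap 𝕜 _ c * v ^ b ∨
        u ^ a * v ^ b = algebraMap 𝕜 _ c) := by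
  obtain ⟨c, m, hc, rfl⟩ := LaurentPolynomial.exists_eq_algebraMap_mul_T_of_isUnit hu
  obtain ⟨d, n, hd, rfl⟩ := LaurentPolynomial.exists_eq_algebraMap_mul_T_of_isUnit hv
  obtain ⟨a, b, hab, h⟩ : ∃ a b : ℕ, ¬(a = 0 ∧ b = 0) ∧
      ((a : ℤ) * m = b * n ∨ (a : ℤ) * m = -(b * n)) := by
    by_cases h0 : n.natAbs = 0 ∧ m.natAbs = 0
    · refine ⟨1, 1, by simp, Or.inl ?_⟩
      rw [Int.natAbs_eq_zero.1 h0.1, Int.natAbs_eq_zero.1 h0.2]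
    · refine ⟨n.natAbs, m.natAbs, h0, Int.natAbs_eq_natAbs_iff.1 ?_⟩
      simp only [Int.natAbs_mul, Int.natAbs_natCast]
      exact mul_comm _ _
  obtain h | h := h
  · refine ⟨a, b, c ^ a, d ^ b, hab, pow_ne_zero _ hc, pow_ne_zero _ hd, Or.inl ?_⟩
    simp only [mul_pow, LaurentPolynomial.T_pow, h, map_pow]
    ring
  · refine ⟨a, b, c ^ a * d ^ b, 1, hab, mul_ne_zero (pow_ne_zero _ hc) (pow_ne_zero _ hd),
      one_ne_zero, Or.inr ?_⟩
    have hT : (LaurentPolynomial.T (a * m) : (𝕜[X])[T;T⁻¹]) * LaurentPolynomial.T (b * n) = 1 := by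
      rw [← LaurentPolynomial.T_add, h, neg_add_cancel, LaurentPolynomial.T_zero]
    simp only [mul_pow, LaurentPolynomial.T_pow, map_mul, map_pow]
    linear_combination (algebraMap 𝕜 (𝕜[X])[T;T⁻¹] c) ^ a * (algebraMap 𝕜 (𝕜[X])[T;T⁻¹] d) ^ b * hT

/-- Let `𝕜` be an integral domain in which `2 ≠ 0`.  Then the mixed polynomial–Laurent
polynomial ring `𝕜[X][Y, Y⁻¹]` and the localization `L` of the polynomial ring `𝕜[X, Y]`
away from `Y² − 2XY` are not isomorphic as `𝕜`-algebras.
(In the polynomial ring, `X = MvPolynomial.X 0` and `Y = MvPolynomial.X 1`.) -/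
theorem statement9 {𝕜 : Type*} [CommRing 𝕜] [IsDomain 𝕜] (h2 : (2 : 𝕜) ≠ 0)
    (L : Type*) [CommRing L] [Algebra (MvPolynomial (Fin 2) 𝕜) L] [Algebra 𝕜 L]
    [IsScalarTower 𝕜 (MvPolynomial (Fin 2) 𝕜) L]
    [IsLocalization.Away
      (MvPolynomial.X 1 ^ 2 - 2 * MvPolynomial.X 0 * MvPolynomial.X 1 :
        MvPolynomial (Fin 2) 𝕜) L] :
    IsEmpty ((𝕜[X])[T;T⁻¹] ≃ₐ[𝕜] L) := by
  refine ⟨fun e => ?_⟩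
  set x : MvPolynomial (Fin 2) 𝕜 := MvPolynomial.X 0
  set y : MvPolynomial (Fin 2) 𝕜 := MvPolynomial.X 1
  have hfac : y ^ 2 - 2 * x * y = y * (y - 2 * x) := by ring
  let ev (s t : 𝕜) : MvPolynomial (Fin 2) 𝕜 →ₐ[𝕜] 𝕜 := MvPolynomial.aeval ![s, t]
  have evx (s t : 𝕜) : ev s t x = s := by simp [ev, x]
  have evy (s t : 𝕜) : ev s t y = t := by simp [ev, y]
  have hne : y ^ 2 - 2 * x * y ≠ 0 := fun h => by
    have := congrArg (ev 0 1) h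
    simp [evx, evy] at this
  have hinj : Function.Injective (algebraMap (MvPolynomial (Fin 2) 𝕜) L) :=
    IsLocalization.injective L (powers_le_nonZeroDivisors_of_noZeroDivisors hne)
  have hy : IsUnit (algebraMap (MvPolynomial (Fin 2) 𝕜) L y) :=
    IsLocalization.Away.isUnit_of_dvd (y ^ 2 - 2 * x * y) (hfac ▸ dvd_mul_right _ _)
  have hz : IsUnit (algebraMap (MvPolynomial (Fin 2) 𝕜) L (y - 2 * x)) :=
    IsLocalization.Away.isUnit_of_dvd (y ^ 2 - 2 * x * y) (hfac ▸ dvd_mul_left _ _)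
  obtain ⟨a, b, c, d, hab, hc, hd, h⟩ :=
    LaurentPolynomial.exists_mul_pow_eq_of_isUnit (hy.map e.symm) (hz.map e.symm)
  obtain h | h := h
  · have h' : algebraMap 𝕜 _ d * y ^ a = algebraMap 𝕜 _ c * (y - 2 * x) ^ b := by
      apply hinj
      have := congrArg e h
      simpa only [map_mul, map_pow, AlgEquiv.commutes, AlgEquiv.apply_symm_apply,
        IsScalarTower.algebraMap_apply 𝕜 (MvPolynomial (Fin 2) 𝕜) L] using this
    have h12 := congrArg (ev 1 2) h'
    have h10 := congrArg (ev 1 0) h'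
    simp only [map_mul, map_pow, map_sub, AlgHom.commutes, evx, evy, map_ofNat,
      Algebra.algebraMap_self, RingHom.id_apply, mul_one, sub_self, zero_sub] at h12 h10
    refine hab ⟨?_, ?_⟩ <;> by_contra h0
    · rw [zero_pow h0, mul_zero] at h10
      exact mul_ne_zero hc (pow_ne_zero _ (neg_ne_zero.2 h2)) h10.symm
    · rw [zero_pow h0, mul_zero] at h12
      exact mul_ne_zero hd (pow_ne_zero _ h2) h12
  · have h' : y ^ a * (y - 2 * x) ^ b = algebraMap 𝕜 _ c := by
      apply hinj
      have := congrArg e h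
      simpa only [map_mul, map_pow, AlgEquiv.commutes, AlgEquiv.apply_symm_apply,
        IsScalarTower.algebraMap_apply 𝕜 (MvPolynomial (Fin 2) 𝕜) L] using this
    have h12 := congrArg (ev 1 2) h'
    have h10 := congrArg (ev 1 0) h'
    simp only [map_mul, map_pow, map_sub, AlgHom.commutes, evx, evy, map_ofNat,
      Algebra.algebraMap_self, RingHom.id_apply, mul_one, sub_self, zero_sub] at h12 h10
    refine hab ⟨?_, ?_⟩ <;> by_contra h0
    · rw [zero_pow h0, zero_mul] at h10
      exact hc h10.symm
    · rw [zero_pow h0, mul_zero] at h12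
      exact hc h12.symm
end
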